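/- Assume the ideal departure times are strictly increasing, d*_1 < d*_2 < … < d*_N. Let Φ : ℝ^N → ℝ^N be a map assigning to every arrival vector a a departure vector Φ(a) such that (a, Φ(a)) satisfies the dynamics, and define c(a) = ∑_{i=1}^N ((Φ(a)_i − d*_i)² + γ(Φ(a)_i − a_i)). If a* minimizes c over ℝ^N, then a*_1 ≤ a*_2 ≤ … ≤ a*_N, and moreover d*_1 − N/(β − α(N−1)) ≤ a*_1 and a*_N ≤ d*_N + N/(β − α(N−1)). -/

import Mathlib

open MeasureTheory Finset

/-- `(a, d)` satisfies the linear-slowdown processor-sharing dynamics. -/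
def SlowdownDynamics (N : ℕ) (α β : ℝ) (a d : Fin N → ℝ) : Prop :=
  (∀ i, a i < d i) ∧
  ∀ i : Fin N,
    (∫ t in (a i)..(d i),
      (β - α * ((∑ j : Fin N, if t ∈ Set.Icc (a j) (d j) then (1 : ℝ) else 0) - 1))) = 1

open scoped Topology

/-- The instantaneous service rate generated by arrivals `a` and departures `d`. -/
noncomputable def serviceRate {N : ℕ} (α β : ℝ) (a d : Fin N → ℝ) (t : ℝ) : ℝ :=
  β - α * ((∑ j : Fin N, if t ∈ Set.Icc (a j) (d j) then (1 : ℝ) else 0) - 1)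

section Dynamics

variable {N : ℕ} {α β : ℝ} {a d d' : Fin N → ℝ}

theorem SlowdownDynamics.integral_serviceRate (h : SlowdownDynamics N α β a d) (i : Fin N) :
    ∫ t in (a i)..(d i), serviceRate α β a d t = 1 :=
  h.2 i

theorem le_serviceRate (hα : 0 ≤ α) (t : ℝ) :
    β - α * ((N : ℝ) - 1) ≤ serviceRate α β a d t := by
  have h : (∑ j : Fin N, if t ∈ Set.Icc (a j) (d j) then (1 : ℝ) else 0) ≤ N := by
    calc _ ≤ ∑ _j : Fin N, (1 : ℝ) := by
          refine Finset.sum_le_sum fun j _ => ?_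
          split_ifs <;> norm_num
      _ = N := by simp
  unfold serviceRate
  gcongr

theorem intervalIntegrable_serviceRate (x y : ℝ) :
    IntervalIntegrable (serviceRate α β a d) volume x y := by
  have hterm : ∀ j : Fin N, IntervalIntegrable
      (fun t => if t ∈ Set.Icc (a j) (d j) then (1 : ℝ) else 0) volume x y := by
    intro j
    have hind : Integrable ((Set.Icc (a j) (d j)).indicator fun _ => (1 : ℝ)) volume :=
      (integrable_indicator_iff measurableSet_Icc).2 (integrableOn_const (by simp))
    refine (hind.intervalIntegrable (a := x) (b := y)).congr fun t _ => ?_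
    exact Set.indicator_apply _ _ t
  have hsum : IntervalIntegrable
      (fun t => ∑ j : Fin N, if t ∈ Set.Icc (a j) (d j) then (1 : ℝ) else 0) volume x y := by
    simpa only [Finset.sum_fn] using
      IntervalIntegrable.sum Finset.univ (fun j _ => hterm j)
  exact intervalIntegrable_const.sub
    ((hsum.sub intervalIntegrable_const).const_mul α)

theorem mul_sub_le_integral_serviceRate (hα : 0 ≤ α) {x y : ℝ} (hxy : x ≤ y) :
    (β - α * ((N : ℝ) - 1)) * (y - x) ≤ ∫ t in x..y, serviceRate α β a d t := by
  have h := intervalIntegral.integral_mono_on (μ := volume) hxy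
    (intervalIntegrable_const (c := β - α * ((N : ℝ) - 1)))
    (intervalIntegrable_serviceRate (α := α) (β := β) (a := a) (d := d) x y)
    (fun t _ => le_serviceRate hα t)
  rw [intervalIntegral.integral_const, smul_eq_mul] at h
  linarith

theorem integral_serviceRate_pos (hα : 0 ≤ α) (hstab : 0 < β - α * ((N : ℝ) - 1))
    {x y : ℝ} (hxy : x < y) : 0 < ∫ t in x..y, serviceRate α β a d t :=
  (mul_pos hstab (sub_pos.2 hxy)).trans_le (mul_sub_le_integral_serviceRate hα hxy.le)

theorem SlowdownDynamics.departure_le (h : SlowdownDynamics N α β a d) (hα : 0 ≤ α)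
    (hstab : 0 < β - α * ((N : ℝ) - 1)) (i : Fin N) :
    d i ≤ a i + 1 / (β - α * ((N : ℝ) - 1)) := by
  have hle := mul_sub_le_integral_serviceRate (β := β) (a := a) (d := d) hα (h.1 i).le
  rw [h.integral_serviceRate i] at hle
  have : d i - a i ≤ 1 / (β - α * ((N : ℝ) - 1)) := by
    rw [le_div_iff₀ hstab]
    linarith
  linarith

theorem SlowdownDynamics.departure_lt_departure (h : SlowdownDynamics N α β a d) (hα : 0 ≤ α)
    (hstab : 0 < β - α * ((N : ℝ) - 1)) {i j : Fin N} (hij : a i < a j) : d i < d j := by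
  by_contra! hle
  have hI := intervalIntegrable_serviceRate (α := α) (β := β) (a := a) (d := d)
  have h₁ := intervalIntegral.integral_add_adjacent_intervals
    (hI (a i) (a j)) (hI (a j) (d j))
  have h₂ := intervalIntegral.integral_add_adjacent_intervals
    (hI (a i) (d j)) (hI (d j) (d i))
  have hpos := integral_serviceRate_pos (a := a) (d := d) hα hstab hij
  have hnonneg := (mul_nonneg hstab.le (sub_nonneg.2 hle)).trans
    (mul_sub_le_integral_serviceRate (a := a) (d := d) hα hle)
  have hi := h.integral_serviceRate i
  have hj := h.integral_serviceRate j
  linarith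

/-- Two solutions cannot first disagree at the departure of user `i`. -/
theorem SlowdownDynamics.not_lt_of_agree_before (h : SlowdownDynamics N α β a d)
    (h' : SlowdownDynamics N α β a d') (hα : 0 ≤ α) (hstab : 0 < β - α * ((N : ℝ) - 1))
    {i : Fin N} (hagree : ∀ j, d j ≠ d' j → d i ≤ d j ∧ d i ≤ d' j) : ¬ d i < d' i := by
  intro hlt
  have hcongr : ∫ t in (a i)..(d i), serviceRate α β a d t =
      ∫ t in (a i)..(d i), serviceRate α β a d' t := by
    refine intervalIntegral.integral_congr fun t ht => ?_
    rw [Set.uIcc_of_le (h.1 i).le] at ht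
    have hiff : ∀ j, t ∈ Set.Icc (a j) (d j) ↔ t ∈ Set.Icc (a j) (d' j) := by
      intro j
      by_cases hj : d j = d' j
      · rw [hj]
      · obtain ⟨h₁, h₂⟩ := hagree j hj
        simp only [Set.mem_Icc, ht.2.trans h₁, ht.2.trans h₂]
    simp only [serviceRate, hiff]
  have hadd := intervalIntegral.integral_add_adjacent_intervals
    (intervalIntegrable_serviceRate (α := α) (β := β) (a := a) (d := d') (a i) (d i))
    (intervalIntegrable_serviceRate (d i) (d' i))
  have hpos := integral_serviceRate_pos (a := a) (d := d') hα hstab hlt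
  have hi := h.integral_serviceRate i
  have hi' := h'.integral_serviceRate i
  linarith

/-- Arrivals determine departures. -/
theorem SlowdownDynamics.unique (h : SlowdownDynamics N α β a d)
    (h' : SlowdownDynamics N α β a d') (hα : 0 ≤ α)
    (hstab : 0 < β - α * ((N : ℝ) - 1)) : d = d' := by
  by_contra hne
  obtain ⟨k, hk⟩ := Function.ne_iff.1 hne
  obtain ⟨i, hi, hmin⟩ := (Finset.univ.filter fun j => d j ≠ d' j).exists_min_image
    (fun j => min (d j) (d' j)) ⟨k, by simpa using hk⟩
  simp only [Finset.mem_filter, Finset.mem_univ, true_and] at hi hmin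
  rcases lt_or_gt_of_ne hi with hlt | hlt
  · refine h.not_lt_of_agree_before h' hα hstab (fun j hj => ?_) hlt
    simpa [min_eq_left hlt.le] using hmin j hj
  · refine h'.not_lt_of_agree_before h hα hstab (fun j hj => ?_) hlt
    simpa [min_eq_right hlt.le, and_comm] using hmin j hj.symm

theorem SlowdownDynamics.comp_perm (h : SlowdownDynamics N α β a d)
    (σ : Equiv.Perm (Fin N)) : SlowdownDynamics N α β (a ∘ σ) (d ∘ σ) := by
  refine ⟨fun i => h.1 (σ i), fun i => ?_⟩
  refine Eq.trans ?_ (h.2 (σ i))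
  refine intervalIntegral.integral_congr fun t _ => ?_
  simp only [Function.comp_apply]
  rw [Equiv.sum_comp σ fun j => if t ∈ Set.Icc (a j) (d j) then (1 : ℝ) else 0]

/-- A group of users whose sojourns stay disjoint from the others' can be translated in time. -/
theorem SlowdownDynamics.shift (h : SlowdownDynamics N α β a d) (G : Finset (Fin N)) (ε : ℝ)
    (hdisj : ∀ i ∈ G, ∀ j ∉ G, Disjoint (Set.Icc (a i) (d i)) (Set.Icc (a j) (d j)))
    (hdisj' : ∀ i ∈ G, ∀ j ∉ G,
      Disjoint (Set.Icc (a i + ε) (d i + ε)) (Set.Icc (a j) (d j))) :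
    SlowdownDynamics N α β (fun i => if i ∈ G then a i + ε else a i)
      (fun i => if i ∈ G then d i + ε else d i) := by
  refine ⟨fun i => ?_, fun i => ?_⟩
  · have := h.1 i
    dsimp only
    split_ifs <;> linarith
  · by_cases hi : i ∈ G
    · refine Eq.trans ?_ (h.2 i)
      simp only [hi, if_true]
      rw [← intervalIntegral.integral_comp_add_right]
      refine intervalIntegral.integral_congr fun t ht => ?_
      rw [Set.uIcc_of_le (h.1 i).le] at ht
      have hiff : ∀ j, t + ε ∈ Set.Icc (if j ∈ G then a j + ε else a j)
          (if j ∈ G then d j + ε else d j) ↔ t ∈ Set.Icc (a j) (d j) := by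
        intro j
        by_cases hj : j ∈ G
        · simp [hj]
        · have h₁ := Set.disjoint_left.1 (hdisj i hi j hj) ht
          have h₂ := Set.disjoint_left.1 (hdisj' i hi j hj)
            (show t + ε ∈ Set.Icc (a i + ε) (d i + ε) by simpa using ht)
          simp only [hj, if_false, h₁, h₂]
      simp only [hiff]
    · refine Eq.trans ?_ (h.2 i)
      simp only [hi, if_false]
      refine intervalIntegral.integral_congr fun t ht => ?_
      rw [Set.uIcc_of_le (h.1 i).le] at ht
      have hiff : ∀ j, t ∈ Set.Icc (if j ∈ G then a j + ε else a j)
          (if j ∈ G then d j + ε else d j) ↔ t ∈ Set.Icc (a j) (d j) := by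
        intro j
        by_cases hj : j ∈ G
        · have h₁ := Set.disjoint_right.1 (hdisj j hj i hi) ht
          have h₂ := Set.disjoint_right.1 (hdisj' j hj i hi) ht
          simp only [hj, if_true, h₁, h₂]
        · simp [hj]
      simp only [hiff]

end Dynamics

/-- The users linked to `i₀` through later overlapping sojourns of length at most `L`
leave within `L` times their number after the arrival of `i₀`. -/
theorem exists_group_before_gap {ι : Type*} [Fintype ι] {a d : ι → ℝ} {L : ℝ}
    (hL : ∀ i, d i ≤ a i + L) (hL₀ : 0 ≤ L) (i₀ : ι) :
    ∃ G : Finset ι, G.Nonempty ∧ (∀ i ∈ G, d i ≤ a i₀ + Fintype.card ι * L) ∧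
      ∀ i ∈ G, ∀ j ∉ G, d i < a j := by
  classical
  obtain ⟨G, ⟨hG, hdG⟩, hmax⟩ := (Set.toFinite {G : Finset ι | G.Nonempty ∧
    ∀ i ∈ G, d i ≤ a i₀ + G.card * L}).exists_maximal
      ⟨{i₀}, Finset.singleton_nonempty i₀, by simpa using hL i₀⟩
  have hcard : (G.card : ℝ) ≤ Fintype.card ι := by exact_mod_cast G.card_le_univ
  refine ⟨G, hG, fun i hi => (hdG i hi).trans (by gcongr), fun i hi j hj => ?_⟩
  by_contra! hle
  refine hj (hmax ⟨Finset.insert_nonempty j G, fun k hk => ?_⟩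
    (Finset.subset_insert j G) (Finset.mem_insert_self j G))
  rw [Finset.card_insert_of_notMem hj]
  push_cast
  rcases Finset.mem_insert.1 hk with rfl | hk
  · linarith [hL k, hdG i hi]
  · linarith [hdG k hk]

/-- Time-reversed form of `exists_group_before_gap`. -/
theorem exists_group_after_gap {ι : Type*} [Fintype ι] {a d : ι → ℝ} {L : ℝ}
    (hL : ∀ i, d i ≤ a i + L) (hL₀ : 0 ≤ L) (i₀ : ι) :
    ∃ G : Finset ι, G.Nonempty ∧ (∀ i ∈ G, d i₀ - Fintype.card ι * L ≤ a i) ∧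
      ∀ i ∈ G, ∀ j ∉ G, d j < a i := by
  obtain ⟨G, hG, hdG, hgap⟩ := exists_group_before_gap (a := fun i => -d i)
    (d := fun i => -a i) (fun i => by linarith [hL i]) hL₀ i₀
  exact ⟨G, hG, fun i hi => by linarith [hdG i hi],
    fun i hi j hj => neg_lt_neg_iff.1 (hgap i hi j hj)⟩

/-- Any minimizer of the total cost is an ordered arrival vector whose coordinates
lie in the interval `[d*_1 − N/(β − α(N−1)), d*_N + N/(β − α(N−1))]`. -/
theorem optimal_schedule_ordered_and_bounded
    (N : ℕ) (hN : 0 < N) (α β : ℝ) (hα : 0 < α) (hβ : 0 < β)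
    (hstab : 0 < β - α * ((N : ℝ) - 1))
    (dstar : Fin N → ℝ) (hdstar : StrictMono dstar) (γ : ℝ) (hγ : 0 ≤ γ)
    (Φ : (Fin N → ℝ) → (Fin N → ℝ))
    (hΦ : ∀ a : Fin N → ℝ, SlowdownDynamics N α β a (Φ a))
    (c : (Fin N → ℝ) → ℝ)
    (hc : ∀ a : Fin N → ℝ,
      c a = ∑ i : Fin N, ((Φ a i - dstar i) ^ 2 + γ * (Φ a i - a i)))
    (astar : Fin N → ℝ) (hmin : ∀ a : Fin N → ℝ, c astar ≤ c a) :
    Monotone astar ∧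
    dstar ⟨0, hN⟩ - (N : ℝ) / (β - α * ((N : ℝ) - 1)) ≤ astar ⟨0, hN⟩ ∧
    astar ⟨N - 1, Nat.sub_lt hN Nat.one_pos⟩ ≤
      dstar ⟨N - 1, Nat.sub_lt hN Nat.one_pos⟩ + (N : ℝ) / (β - α * ((N : ℝ) - 1)) := by
  have hv : 0 ≤ 1 / (β - α * ((N : ℝ) - 1)) := by positivity
  have hdyn := hΦ astar
  have hlen := hdyn.departure_le hα.le hstab
  have hcost : ∀ a d, SlowdownDynamics N α β a d →
      ∑ i, ((Φ astar i - dstar i) ^ 2 + γ * (Φ astar i - astar i)) ≤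
        ∑ i, ((d i - dstar i) ^ 2 + γ * (d i - a i)) := by
    intro a d h
    rw [h.unique (hΦ a) hα.le hstab, ← hc, ← hc]
    exact hmin a
  have hshift : ∀ (G : Finset (Fin N)) (ε : ℝ), G.Nonempty →
      (∀ i ∈ G, ∀ j ∉ G,
        Disjoint (Set.Icc (astar i) (Φ astar i)) (Set.Icc (astar j) (Φ astar j))) →
      (∀ i ∈ G, ∀ j ∉ G,
        Disjoint (Set.Icc (astar i + ε) (Φ astar i + ε)) (Set.Icc (astar j) (Φ astar j))) →
      ¬ ∀ i ∈ G, (Φ astar i + ε - dstar i) ^ 2 < (Φ astar i - dstar i) ^ 2 := by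
    intro G ε ⟨k, hk⟩ h₁ h₂ hlt
    refine (hcost _ _ (hdyn.shift G ε h₁ h₂)).not_gt
      (Finset.sum_lt_sum (fun i _ => ?_) ⟨k, Finset.mem_univ k, ?_⟩)
    · by_cases hi : i ∈ G
      · simp only [hi, if_true, add_sub_add_right_eq_sub]
        linarith [hlt i hi]
      · simp [hi]
    · simp only [hk, if_true, add_sub_add_right_eq_sub]
      linarith [hlt k hk]
  refine ⟨fun i j hij => ?_, ?_, ?_⟩
  · rcases hij.eq_or_lt with rfl | hij
    · exact le_rfl
    by_contra! hlt
    have hd := hdyn.departure_lt_departure hα.le hstab hlt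
    have hle := hcost _ _ (hdyn.comp_perm (Equiv.swap i j))
    have hsplit : ∀ a d : Fin N → ℝ, ∑ k, ((d k - dstar k) ^ 2 + γ * (d k - a k)) =
        ∑ k, (d k ^ 2 + γ * (d k - a k)) + ∑ k, dstar k ^ 2 - 2 * ∑ k, d k * dstar k := by
      intro a d
      rw [Finset.mul_sum, ← Finset.sum_add_distrib, ← Finset.sum_sub_distrib]
      exact Finset.sum_congr rfl fun k _ => by ring
    rw [hsplit, hsplit] at hle
    simp only [Function.comp_apply] at hle
    rw [Equiv.sum_comp (Equiv.swap i j)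
      fun k => Φ astar k ^ 2 + γ * (Φ astar k - astar k)] at hle
    have hgain : 0 < ∑ k, (Φ astar (Equiv.swap i j k) * dstar k - Φ astar k * dstar k) := by
      rw [← Finset.sum_subset (Finset.subset_univ {i, j}), Finset.sum_pair hij.ne,
        Equiv.swap_apply_left, Equiv.swap_apply_right]
      · nlinarith [mul_pos (sub_pos.2 hd) (sub_pos.2 (hdstar hij))]
      · intro k _ hk
        simp only [Finset.mem_insert, Finset.mem_singleton, not_or] at hk
        rw [Equiv.swap_apply_of_ne_of_ne hk.1 hk.2, sub_self]
    rw [Finset.sum_sub_distrib] at hgain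
    linarith
  · by_contra! hlt
    obtain ⟨G, hG, hdG, hgap⟩ := exists_group_before_gap hlen hv ⟨0, hN⟩
    rw [Fintype.card_fin, mul_one_div] at hdG
    have hlate : ∀ i ∈ G, Φ astar i < dstar i := fun i hi => by
      have : dstar ⟨0, hN⟩ ≤ dstar i := hdstar.monotone (Fin.mk_le_of_le_val (Nat.zero_le _))
      linarith [hdG i hi]
    have hev : ∀ᶠ ε in 𝓝[>] (0 : ℝ), 0 < ε ∧ (∀ i ∈ G, ε < dstar i - Φ astar i) ∧
        ∀ i ∈ G, ∀ j ∈ Gᶜ, ε < astar j - Φ astar i := by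
      refine eventually_mem_nhdsWithin.and (Filter.Eventually.and ?_ ?_)
      · exact (Filter.eventually_all_finset G).2 fun i hi =>
          eventually_nhdsWithin_of_eventually_nhds (eventually_lt_nhds (sub_pos.2 (hlate i hi)))
      · refine (Filter.eventually_all_finset G).2 fun i hi =>
          (Filter.eventually_all_finset Gᶜ).2 fun j hj =>
            eventually_nhdsWithin_of_eventually_nhds (eventually_lt_nhds (sub_pos.2 ?_))
        exact hgap i hi j (Finset.mem_compl.1 hj)
    obtain ⟨ε, hε, hεd, hεa⟩ := hev.exists
    refine hshift G ε hG (fun i hi j hj => ?_) (fun i hi j hj => ?_) fun i hi => ?_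
    · have := hgap i hi j hj
      exact Set.disjoint_left.2 fun t h₁ h₂ => by linarith [h₁.2, h₂.1]
    · have := hεa i hi j (Finset.mem_compl.2 hj)
      exact Set.disjoint_left.2 fun t h₁ h₂ => by linarith [h₁.2, h₂.1]
    · nlinarith [hεd i hi, hlate i hi]
  · by_contra! hlt
    obtain ⟨G, hG, hdG, hgap⟩ :=
      exists_group_after_gap hlen hv ⟨N - 1, Nat.sub_lt hN Nat.one_pos⟩
    rw [Fintype.card_fin, mul_one_div] at hdG
    have hearly : ∀ i ∈ G, dstar i < Φ astar i := fun i hi => by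
      have : dstar i ≤ dstar ⟨N - 1, Nat.sub_lt hN Nat.one_pos⟩ :=
        hdstar.monotone (Fin.le_def.2 (Nat.le_sub_one_of_lt i.2))
      linarith [hdG i hi, hdyn.1 i, hdyn.1 ⟨N - 1, Nat.sub_lt hN Nat.one_pos⟩]
    have hev : ∀ᶠ ε in 𝓝[>] (0 : ℝ), 0 < ε ∧ (∀ i ∈ G, ε < Φ astar i - dstar i) ∧
        ∀ i ∈ G, ∀ j ∈ Gᶜ, ε < astar i - Φ astar j := by
      refine eventually_mem_nhdsWithin.and (Filter.Eventually.and ?_ ?_)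
      · exact (Filter.eventually_all_finset G).2 fun i hi =>
          eventually_nhdsWithin_of_eventually_nhds (eventually_lt_nhds (sub_pos.2 (hearly i hi)))
      · refine (Filter.eventually_all_finset G).2 fun i hi =>
          (Filter.eventually_all_finset Gᶜ).2 fun j hj =>
            eventually_nhdsWithin_of_eventually_nhds (eventually_lt_nhds (sub_pos.2 ?_))
        exact hgap i hi j (Finset.mem_compl.1 hj)
    obtain ⟨ε, hε, hεd, hεa⟩ := hev.exists
    refine hshift G (-ε) hG (fun i hi j hj => ?_) (fun i hi j hj => ?_) fun i hi => ?_
    · have := hgap i hi j hj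
      exact Set.disjoint_left.2 fun t h₁ h₂ => by linarith [h₁.1, h₂.2]
    · have := hεa i hi j (Finset.mem_compl.2 hj)
      exact Set.disjoint_left.2 fun t h₁ h₂ => by linarith [h₁.1, h₂.2]
    · nlinarith [hεd i hi, hearly i hi]
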